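/- For every positive integer s and every nonnegative integer t, there exists a finite simple graph G such that χ(G) = ω(G) = s + 1, the non-chordality index i(G) equals t, and the list chromatic number χ_l(G) equals s + t + 1. -/

import Mathlib

open SimpleGraph

variable {V : Type*}

/-- A *hole* of `G`: an induced cycle of length at least 4, given as a closed walk. -/
def IsHole (G : SimpleGraph V) {a : V} (w : G.Walk a a) : Prop :=
  w.IsCycle ∧ 4 ≤ w.length ∧
    ∀ x y : V, x ∈ w.support → y ∈ w.support → G.Adj x y → s(x, y) ∈ w.edges

/-- A graph is *chordal* if it has no hole. -/
def IsChordal (G : SimpleGraph V) : Prop :=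
  ∀ (a : V) (w : G.Walk a a), ¬ IsHole G w

/-- Two edge lists share two consecutive edges. -/
def ShareTwoConsecutiveEdges (l₁ l₂ : List (Sym2 V)) : Prop :=
  ∃ x y z : V, x ≠ z ∧ s(x, y) ∈ l₁ ∧ s(y, z) ∈ l₁ ∧ s(x, y) ∈ l₂ ∧ s(y, z) ∈ l₂

/-- A vertex `u` satisfies the *NC property* in `G`: no hole through `u` and
no hole avoiding `u` share two consecutive edges. -/
def VertexNC (G : SimpleGraph V) (u : V) : Prop :=
  ∀ (a b : V) (w₁ : G.Walk a a) (w₂ : G.Walk b b),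
    IsHole G w₁ → IsHole G w₂ → u ∈ w₁.support → u ∉ w₂.support →
      ¬ ShareTwoConsecutiveEdges w₁.edges w₂.edges

/-- A *hole cover* of `G`: a nonempty vertex set meeting every hole of `G`. -/
def IsHoleCover (G : SimpleGraph V) (C : Set V) : Prop :=
  C.Nonempty ∧ ∀ (a : V) (w : G.Walk a a), IsHole G w → ∃ u ∈ C, u ∈ w.support

/-- A vertex set `C` satisfies the *NC property* in `G`: every vertex of `C`
satisfies the NC property and every hole of `G` contains at most one vertex of `C`. -/
def SetNC (G : SimpleGraph V) (C : Set V) : Prop :=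
  (∀ u ∈ C, VertexNC G u) ∧
    ∀ (a : V) (w : G.Walk a a), IsHole G w →
      ∀ u ∈ C, ∀ v ∈ C, u ∈ w.support → v ∈ w.support → u = v

/-- A graph satisfies the *NC property* if it has a hole cover satisfying the NC property. -/
def HasNCProperty (G : SimpleGraph V) : Prop :=
  ∃ C : Set V, IsHoleCover G C ∧ SetNC G C

/-- A DP-cover of `G` with lists of size `k`, realized on the vertex set `V × Fin k`:
the fibers `{v} × Fin k` are cliques, cross edges exist only over edges of `G`,
and the edges between two fibers form a matching. -/
def IsDPCover (G : SimpleGraph V) (k : ℕ) (H : SimpleGraph (V × Fin k)) : Prop :=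
  (∀ (v : V) (i j : Fin k), i ≠ j → H.Adj (v, i) (v, j)) ∧
  (∀ (u v : V) (i j : Fin k), u ≠ v → H.Adj (u, i) (v, j) → G.Adj u v) ∧
  (∀ (u v : V) (i j j' : Fin k), u ≠ v → H.Adj (u, i) (v, j) → H.Adj (u, i) (v, j') → j = j')

/-- `G` is DP-`k`-colorable: every DP-cover with lists of size `k` admits an
independent transversal. -/
def DPColorable (G : SimpleGraph V) (k : ℕ) : Prop :=
  ∀ H : SimpleGraph (V × Fin k), IsDPCover G k H →
    ∃ f : V → Fin k, ∀ u v : V, ¬ H.Adj (u, f u) (v, f v)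

/-- The DP-chromatic number: the least `k` such that `G` is DP-`k`-colorable. -/
noncomputable def dpChromaticNumber (G : SimpleGraph V) : ℕ :=
  sInf {k | DPColorable G k}

/-- `M` is a minor of `G`, via the branch-set characterization. -/
def HasMinor {W : Type*} (G : SimpleGraph V) (M : SimpleGraph W) : Prop :=
  ∃ B : W → Set V,
    (∀ i, (B i).Nonempty) ∧
    (∀ i, (G.induce (B i)).Connected) ∧
    (Pairwise fun i j => Disjoint (B i) (B j)) ∧
    ∀ i j, M.Adj i j → ∃ a ∈ B i, ∃ b ∈ B j, G.Adj a b

/-- Locally chordalize by `u` all holes of `G` containing `u`: add all edges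
joining `u` to the vertices of such holes (new edges go to the vertices
nonadjacent to `u`). -/
def localChordalize (G : SimpleGraph V) (u : V) : SimpleGraph V :=
  G ⊔ SimpleGraph.fromRel fun x y =>
    x = u ∧ ∃ (a : V) (w : G.Walk a a), IsHole G w ∧ u ∈ w.support ∧ y ∈ w.support

/-- Recursive local chordalizations along a list of vertices. -/
def chordalizeList (G : SimpleGraph V) : List V → SimpleGraph V
  | [] => G
  | u :: l => chordalizeList (localChordalize G u) l

/-- Delete a vertex set (keeping the ambient vertex type: the removed vertices
become isolated). -/
def removeVerts (G : SimpleGraph V) (A : Set V) : SimpleGraph V where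
  Adj x y := G.Adj x y ∧ x ∉ A ∧ y ∉ A
  symm := ⟨by intro x y h; exact ⟨h.1.symm, h.2.2, h.2.1⟩⟩
  loopless := ⟨by intro x h; exact G.loopless.irrefl x h.1⟩

/-- The chordalization chain corresponding to an ordered partition
`parts 0, …, parts (k-1)` (playing the role of `C₁, …, C_k`) of a hole cover:
`(lcChain G parts i).1 = Gᵢ` and `(lcChain G parts i).2 = Gᵢ*`. -/
def lcChain (G : SimpleGraph V) {k : ℕ} (parts : Fin k → List V) :
    ℕ → SimpleGraph V × SimpleGraph V
  | 0 =>
      (removeVerts G {v | ∃ i, v ∈ parts i}, removeVerts G {v | ∃ i, v ∈ parts i})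
  | i + 1 =>
      let Gi := (lcChain G parts i).2 ⊔
        removeVerts G {v | ∃ j : Fin k, i + 1 ≤ (j : ℕ) ∧ v ∈ parts j}
      (Gi, if h : i < k then chordalizeList Gi (parts ⟨i, h⟩) else Gi)

/-- `(parts 0, …, parts (k-1))` is a *local chordalization partition* of the hole
cover `C` of `G`. -/
def IsLCPartition (G : SimpleGraph V) (C : Set V) {k : ℕ} (parts : Fin k → List V) : Prop :=
  (∀ i, (parts i).Nodup) ∧
  (∀ i, parts i ≠ []) ∧
  (Pairwise fun i j : Fin k => ∀ v, v ∈ parts i → v ∉ parts j) ∧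
  {v | ∃ i, v ∈ parts i} = C ∧
  ∀ i : Fin k,
    IsHoleCover (lcChain G parts ((i : ℕ) + 1)).1 {v | v ∈ parts i} ∧
    SetNC (lcChain G parts ((i : ℕ) + 1)).1 {v | v ∈ parts i} ∧
    IsChordal (lcChain G parts ((i : ℕ) + 1)).2

/-- The *non-chordality index* of `G`. -/
noncomputable def ncIndex (G : SimpleGraph V) : ℕ := by
  classical exact
    if IsChordal G then 0
    else sInf {k | ∃ (C : Set V) (parts : Fin k → List V),
      IsHoleCover G C ∧ IsLCPartition G C parts}

/-- `G` is `k`-list-colorable. -/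
def ListColorable (G : SimpleGraph V) (k : ℕ) : Prop :=
  ∀ L : V → Finset ℕ, (∀ v, k ≤ (L v).card) →
    ∃ f : V → ℕ, (∀ v, f v ∈ L v) ∧ ∀ u v : V, G.Adj u v → f u ≠ f v

/-- The list chromatic number of `G`. -/
noncomputable def listChromaticNumber (G : SimpleGraph V) : ℕ :=
  sInf {k | ListColorable G k}

/-! ### Generalities on holes -/

/-- A four-cycle without chords is a hole. -/
lemma hole4 (G : SimpleGraph V) {p r q s : V} (h1 : G.Adj p r) (h2 : G.Adj r q)
    (h3 : G.Adj q s) (h4 : G.Adj s p) (hpq : p ≠ q) (hrs : r ≠ s)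
    (n1 : ¬ G.Adj p q) (n2 : ¬ G.Adj r s) :
    ∃ w : G.Walk p p, IsHole G w ∧ (∀ x, x ∈ w.support ↔ x = p ∨ x = r ∨ x = q ∨ x = s) ∧
      s(p, r) ∈ w.edges ∧ s(r, q) ∈ w.edges ∧ s(q, s) ∈ w.edges ∧ s(s, p) ∈ w.edges := by
  refine ⟨.cons h1 (.cons h2 (.cons h3 (.cons h4 .nil))), ⟨?_, ?_, ?_⟩, ?_, ?_⟩
  · have := h1.ne; have := h2.ne; have := h3.ne; have := h4.ne
    rw [Walk.isCycle_def, Walk.isTrail_def]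
    refine ⟨?_, by simp, ?_⟩
    · simp; grind
    · simp; grind
  · simp
  · intro x y hx hy hxy
    have hn1 : ¬ G.Adj q p := fun h => n1 h.symm
    have hn2 : ¬ G.Adj s r := fun h => n2 h.symm
    have := hxy.ne
    simp at hx hy ⊢
    grind
  · intro x; simp; grind
  · simp

/-- Local structure of a hole around one of its vertices. -/
lemma hole_local (G : SimpleGraph V) {a : V} (w : G.Walk a a) (hw : IsHole G w) {u : V}
    (hu : u ∈ w.support) :
    ∃ x y z, x ∈ w.support ∧ y ∈ w.support ∧ z ∈ w.support ∧ G.Adj u x ∧ G.Adj u y ∧ x ≠ y ∧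
      ¬ G.Adj x y ∧ z ≠ u ∧ ¬ G.Adj u z ∧ G.Adj x z := by
  classical
  obtain ⟨hc, hl, hi⟩ := hw
  obtain ⟨f, n, hL, h0, hn, hsup, hstep, inj, hedge⟩ : ∃ (f : ℕ → V) (n : ℕ), 4 ≤ n ∧ f 0 = u ∧
      f n = u ∧ (∀ i, f i ∈ w.support) ∧ (∀ i, i < n → G.Adj (f i) (f (i + 1))) ∧
      (∀ i j, i ≤ n - 1 → j ≤ n - 1 → f i = f j → i = j) ∧
      (∀ x y, s(x, y) ∈ w.edges → ∃ i < n, s(f i, f (i + 1)) = s(x, y)) := by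
    have hc' := hc.rotate hu
    refine ⟨(w.rotate u hu).getVert, (w.rotate u hu).length, by simpa using hl, by simp,
      Walk.getVert_length _,
      fun i => (w.mem_support_rotate_iff u hu).1 (Walk.getVert_mem_support _ i),
      fun i h => Walk.adj_getVert_succ _ h, fun i j h1 h2 h => hc'.getVert_injOn' h1 h2 h, ?_⟩
    intro x y hxy
    exact (Walk.mk_mem_edges_iff_exists _).1 ((w.rotate_edges u hu).mem_iff.2 hxy)
  have a1 : G.Adj (f 0) (f 1) := hstep 0 (by omega)
  have a2 : G.Adj (f 1) (f 2) := hstep 1 (by omega)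
  have a3 : G.Adj (f (n - 1)) (f n) := by
    have := hstep (n - 1) (by omega)
    rwa [Nat.sub_add_cancel (by omega)] at this
  have key : ∀ i j, i ≤ n - 1 → j ≤ n - 1 → G.Adj (f i) (f j) →
      i + 1 = j ∨ j + 1 = i ∨ (i = 0 ∧ j = n - 1) ∨ (j = 0 ∧ i = n - 1) := by
    intro i j hi1 hj1 hadj
    obtain ⟨k, hk, he⟩ := hedge _ _ (hi _ _ (hsup i) (hsup j) hadj)
    by_cases hk1 : k + 1 = n
    · rw [hk1, hn, ← h0, Sym2.eq_iff] at he
      have h00 : 0 ≤ n - 1 := by omega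
      have hkk : k ≤ n - 1 := by omega
      rcases he with ⟨e1, e2⟩ | ⟨e1, e2⟩
      · have := inj _ _ hkk hi1 e1
        have := inj _ _ h00 hj1 e2
        omega
      · have := inj _ _ hkk hj1 e1
        have := inj _ _ h00 hi1 e2
        omega
    · rw [Sym2.eq_iff] at he
      have hkk : k ≤ n - 1 := by omega
      have hkk1 : k + 1 ≤ n - 1 := by omega
      rcases he with ⟨e1, e2⟩ | ⟨e1, e2⟩
      · have := inj _ _ hkk hi1 e1
        have := inj _ _ hkk1 hj1 e2
        omega
      · have := inj _ _ hkk hj1 e1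
        have := inj _ _ hkk1 hi1 e2
        omega
  rw [hn] at a3
  rw [h0] at a1
  refine ⟨f 1, f (n - 1), f 2, hsup _, hsup _, hsup _, a1, a3.symm, ?_, ?_, ?_, ?_, a2⟩
  · intro h
    have := inj _ _ (by omega) (by omega) h
    omega
  · intro h
    have := key _ _ (by omega) (by omega) h
    omega
  · intro h
    rw [← h0] at h
    have := inj _ _ (by omega) (by omega) h
    omega
  · intro h
    rw [← h0] at h
    have := key _ _ (by omega) (by omega) h
    omega

lemma localChordalize_le (G : SimpleGraph V) (u : V) : G ≤ localChordalize G u := le_sup_left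

lemma le_chordalizeList (l : List V) : ∀ G : SimpleGraph V, G ≤ chordalizeList G l := by
  induction l with
  | nil => intro G; exact le_refl _
  | cons u l ih => intro G; exact (localChordalize_le G u).trans (ih _)

lemma localChordalize_adj (G : SimpleGraph V) (u : V) {x y : V}
    (h : (localChordalize G u).Adj x y) : G.Adj x y ∨ (x ≠ y ∧ (x = u ∨ y = u) ∧
      ∃ (a : V) (w : G.Walk a a), IsHole G w ∧ u ∈ w.support ∧ x ∈ w.support ∧ y ∈ w.support) := by
  rcases h with h | h
  · exact Or.inl h
  · rw [SimpleGraph.fromRel_adj] at h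
    obtain ⟨hne, ⟨rfl, a, w, h1, h2, h3⟩ | ⟨rfl, a, w, h1, h2, h3⟩⟩ := h
    · exact Or.inr ⟨hne, Or.inl rfl, a, w, h1, h2, h2, h3⟩
    · exact Or.inr ⟨hne, Or.inr rfl, a, w, h1, h2, h3, h2⟩

lemma chordalizeList_of_chordal (l : List V) (G : SimpleGraph V) (hG : IsChordal G) :
    chordalizeList G l = G := by
  induction l with
  | nil => rfl
  | cons u l ih =>
    have : localChordalize G u = G := by
      apply le_antisymm _ (localChordalize_le G u)
      intro x y h
      rcases localChordalize_adj G u h with h | ⟨_, _, a, w, hw, _⟩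
      · exact h
      · exact absurd hw (hG a w)
    simp only [chordalizeList, this, ih]

/-- One chordalization step, the main case. `p` is the centre of the star of non-edges. -/
lemma step_main (H : SimpleGraph V) (D C : Set V) (side : V → Bool)
    (hal : ∀ x y, H.Adj x y → x ∉ D ∧ y ∉ D)
    (hcr : ∀ x y, side x ≠ side y → x ∉ D → y ∉ D → H.Adj x y)
    (hcov : IsHoleCover H C) (hNC : SetNC H C)
    {p q r s : V} (hp : p ∉ D) (hq : q ∉ D) (hr : r ∉ D) (hs : s ∉ D) (hpq : p ≠ q) (hrs : r ≠ s)
    (npq : ¬ H.Adj p q) (nrs : ¬ H.Adj r s)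
    (spq : side q = side p) (sr : side r ≠ side p) (ss : side s ≠ side p) (hpC : p ∈ C)
    (l : List V) (hl : ∀ u ∈ l, u ∈ C) :
    (∀ x y, (chordalizeList H l).Adj x y → x ∉ D ∧ y ∉ D) ∧
    ∀ x y, x ≠ p → y ≠ p → (chordalizeList H l).Adj x y → H.Adj x y := by
  -- four-holes across the two sides
  have cross : ∀ a b c d, a ∉ D → b ∉ D → c ∉ D → d ∉ D → a ≠ c → b ≠ d → ¬ H.Adj a c →
      ¬ H.Adj b d → side c = side a → side b ≠ side a → side d ≠ side a →
      ∃ w : H.Walk a a, IsHole H w ∧ (∀ x, x ∈ w.support ↔ x = a ∨ x = b ∨ x = c ∨ x = d) ∧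
      s(a, b) ∈ w.edges ∧ s(b, c) ∈ w.edges ∧ s(c, d) ∈ w.edges ∧ s(d, a) ∈ w.edges := by
    intro a b c d ha hb hc hd hac hbd nac nbd sca sba sda
    exact hole4 H (hcr _ _ sba.symm ha hb) (hcr _ _ (by rw [sca]; exact sba) hb hc)
      (hcr _ _ (by rw [sca]; exact sda.symm) hc hd) (hcr _ _ sda hd ha) hac hbd nac nbd
  have c1 : ∀ y y', y ∉ D → y' ∉ D → y ≠ y' → ¬ H.Adj y y' → side y ≠ side p →
      side y' ≠ side p → y ∉ C := by
    intro y y' hy hy' hne hn sy sy' hyC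
    obtain ⟨w, hw, hsup, -⟩ := cross p y q y' hp hy hq hy' hpq hne npq hn spq sy sy'
    have := hNC.2 _ w hw p hpC y hyC ((hsup _).2 (by simp)) ((hsup _).2 (by simp))
    exact sy (by rw [this])
  have hrC : r ∉ C := c1 r s hr hs hrs nrs sr ss
  have hsC : s ∉ C := c1 s r hs hr hrs.symm (fun h => nrs h.symm) ss sr
  have hrp : r ≠ p := fun h => sr (by rw [h])
  have hsp : s ≠ p := fun h => ss (by rw [h])
  have cNC : ∀ d d', d ∉ D → d' ∉ D → d ≠ d' → ¬ H.Adj d d' → side d = side p →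
      side d' = side p → d ≠ p → d' ≠ p → ¬ H.Adj p d' → False := by
    intro d d' hd hd' hne hn sd sd' hdp hdp' hnp
    obtain ⟨w, hw, hsup, e1, e2, e3, e4⟩ := cross p r d' s hp hr hd' hs hdp'.symm hrs hnp nrs
      sd' sr ss
    obtain ⟨w', hw', hsup', f1, f2, f3, f4⟩ := cross d r d' s hd hr hd' hs hne hrs hn nrs
      (by rw [sd, sd']) (by rw [sd]; exact sr) (by rw [sd]; exact ss)
    refine hNC.1 p hpC _ _ w w' hw hw' ((hsup _).2 (by simp)) ?_
      ⟨r, d', s, hrs, e2, e3, f2, f3⟩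
    rw [hsup']
    rintro (h | h | h | h)
    · exact hdp h.symm
    · exact hrp h.symm
    · exact hdp' h.symm
    · exact hsp h.symm
  have cD : ∀ d d', d ∉ D → d' ∉ D → d ≠ d' → ¬ H.Adj d d' → side d = side p →
      side d' = side p → d ≠ p → d' ≠ p → d ∈ C → False := by
    intro d d' hd hd' hne hn sd sd' hdp hdp' hdC
    have hn' : ¬ H.Adj d' d := fun h => hn h.symm
    have p1 : H.Adj p d' := by
      by_contra h; exact cNC d d' hd hd' hne hn sd sd' hdp hdp' h
    have p2 : H.Adj p d := by
      by_contra h; exact cNC d' d hd' hd hne.symm hn' sd' sd hdp' hdp h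
    have hqd : q ≠ d := by rintro rfl; exact npq p2
    have hqd' : q ≠ d' := by rintro rfl; exact npq p1
    have p3 : H.Adj q d := by
      by_contra h
      exact cNC d q hd hq hqd.symm (fun h' => h h'.symm) sd spq hdp hpq.symm npq
    have p4 : H.Adj q d' := by
      by_contra h
      exact cNC d' q hd' hq hqd'.symm (fun h' => h h'.symm) sd' spq hdp' hpq.symm npq
    obtain ⟨w, hw, hsup, -⟩ := hole4 H p2 p3.symm p4 p1.symm hpq hne npq hn
    exact hdp (hNC.2 _ w hw p hpC d hdC ((hsup _).2 (by simp)) ((hsup _).2 (by simp))).symm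
  have c2 : ∀ d d', d ∉ D → d' ∉ D → d ≠ d' → ¬ H.Adj d d' → side d = side p →
      side d' = side p → d ≠ p → d' ≠ p → False := by
    intro d d' hd hd' hne hn sd sd' hdp hdp'
    obtain ⟨w', hw', hsup', -⟩ := cross d r d' s hd hr hd' hs hne hrs hn nrs
      (by rw [sd, sd']) (by rw [sd]; exact sr) (by rw [sd]; exact ss)
    obtain ⟨u, huC, hu⟩ := hcov.2 _ w' hw'
    rcases (hsup' _).1 hu with rfl | rfl | rfl | rfl
    · exact cD u d' hd hd' hne hn sd sd' hdp hdp' huC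
    · exact hrC huC
    · exact cD u d hd' hd hne.symm (fun h => hn h.symm) sd' sd hdp' hdp huC
    · exact hsC huC
  have inv : ∀ l : List V, (∀ u ∈ l, u ∈ C) → ∀ K : SimpleGraph V, H ≤ K →
      (∀ x y, K.Adj x y → H.Adj x y ∨ (x ∉ D ∧ y ∉ D ∧ side x = side p ∧ side y = side p)) →
      ∀ x y, (chordalizeList K l).Adj x y →
        H.Adj x y ∨ (x ∉ D ∧ y ∉ D ∧ side x = side p ∧ side y = side p) := by
    intro l
    induction l with
    | nil => intro _ K _ hK; exact hK
    | cons u l ih =>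
      intro hl K hHK hK
      refine ih (fun v hv => hl v (by simp [hv])) _ (hHK.trans (localChordalize_le _ _)) ?_
      intro x y hxy
      have huC : u ∈ C := hl u (by simp)
      rcases localChordalize_adj K u hxy with h | ⟨hne, hxu, a, w, hw, hu, hx, hy⟩
      · exact hK x y h
      by_cases hH : H.Adj x y
      · exact Or.inl hH
      have alive : ∀ v, v ∈ w.support → v ∉ D := by
        intro v hv
        obtain ⟨z, -, -, -, -, -, hz, -⟩ := hole_local K w hw hv
        rcases hK _ _ hz with h | h
        · exact (hal _ _ h).1
        · exact h.1
      have hxD := alive x hx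
      have hyD := alive y hy
      have hside : side x = side y := by
        by_contra h
        exact hH (hcr _ _ h hxD hyD)
      have : side x = side p := by
        by_contra h
        rcases hxu with rfl | rfl
        · exact c1 x y hxD hyD hne hH h (hside ▸ h) huC
        · exact c1 y x hyD hxD hne.symm (fun h => hH h.symm) (hside ▸ h) h huC
      exact Or.inr ⟨hxD, hyD, this, hside ▸ this⟩
  have fin := inv l hl H le_rfl (fun x y h => Or.inl h)
  refine ⟨fun x y h => ?_, fun x y hx hy h => ?_⟩
  · rcases fin x y h with h | h
    · exact hal _ _ h
    · exact ⟨h.1, h.2.1⟩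
  · rcases fin x y h with h' | ⟨h1, h2, h3, h4⟩
    · exact h'
    · by_contra hn
      exact c2 x y h1 h2 h.ne hn h3 h4 hx hy

/-- One chordalization step. -/
lemma step_one (G H : SimpleGraph V) (D C : Set V) (side : V → Bool)
    (Gcr : ∀ x y, side x ≠ side y → G.Adj x y)
    (Gtr : ∀ u x y, G.Adj u x → G.Adj u y → side x = side u → side y = side u → x ≠ y → G.Adj x y)
    (hal : ∀ x y, H.Adj x y → x ∉ D ∧ y ∉ D)
    (hGH : ∀ x y, G.Adj x y → x ∉ D → y ∉ D → H.Adj x y)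
    (hC : ∀ u ∈ C, ∀ x, H.Adj u x → G.Adj u x)
    (hcov : IsHoleCover H C) (hNC : SetNC H C)
    (l : List V) (hl : ∀ u ∈ l, u ∈ C) :
    (∀ x y, (chordalizeList H l).Adj x y → x ∉ D ∧ y ∉ D) ∧
    ∃ p, ∀ x y, x ≠ p → y ≠ p → (chordalizeList H l).Adj x y → H.Adj x y := by
  have hcr : ∀ x y, side x ≠ side y → x ∉ D → y ∉ D → H.Adj x y :=
    fun x y h hx hy => hGH x y (Gcr x y h) hx hy
  by_cases hch : IsChordal H
  · rw [chordalizeList_of_chordal l H hch]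
    exact ⟨hal, hcov.1.some, fun x y _ _ h => h⟩
  unfold IsChordal at hch
  push Not at hch
  obtain ⟨a, w, hw⟩ := hch
  obtain ⟨u, huC, hu⟩ := hcov.2 a w hw
  obtain ⟨x, y, z, hx, hy, hz, hux, huy, hxy, nxy, hzu, nuz, hxz⟩ := hole_local H w hw hu
  have huD := (hal _ _ hux).1
  have hxD := (hal _ _ hux).2
  have hyD := (hal _ _ huy).2
  have hzD := (hal _ _ hxz).2
  have s1 : side x = side y := by
    by_contra h; exact nxy (hcr _ _ h hxD hyD)
  have s2 : side u = side z := by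
    by_contra h; exact nuz (hcr _ _ h huD hzD)
  have s3 : side x ≠ side u := by
    intro h
    exact nxy (hGH _ _ (Gtr u x y (hC u huC x hux) (hC u huC y huy) h (s1 ▸ h) hxy) hxD hyD)
  have := step_main H D C side hal hcr hcov hNC huD hzD hxD hyD hzu.symm hxy nuz nxy s2.symm
    s3 (s1 ▸ s3) huC l hl
  exact ⟨this.1, u, this.2⟩

/-- The set of vertices which have not been inserted yet. -/
def deadSet {k : ℕ} (parts : Fin k → List V) (i : ℕ) : Set V :=
  {v | ∃ j : Fin k, i ≤ (j : ℕ) ∧ v ∈ parts j}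

lemma chain_inv (G : SimpleGraph V) (side : V → Bool)
    (Gcr : ∀ x y, side x ≠ side y → G.Adj x y)
    (Gtr : ∀ u x y, G.Adj u x → G.Adj u y → side x = side u → side y = side u → x ≠ y → G.Adj x y)
    {k : ℕ} (parts : Fin k → List V) (C : Set V) (hP : IsLCPartition G C parts) :
    ∀ i, i ≤ k → (∀ x y, (lcChain G parts i).2.Adj x y →
        x ∉ deadSet parts i ∧ y ∉ deadSet parts i) ∧
      (∀ x y, G.Adj x y → x ∉ deadSet parts i → y ∉ deadSet parts i →
        (lcChain G parts i).2.Adj x y) ∧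
      ∃ R : Finset V, R.card ≤ i ∧
        ∀ x y, x ∉ R → y ∉ R → (lcChain G parts i).2.Adj x y → G.Adj x y := by
  classical
  intro i
  induction i with
  | zero =>
    intro _
    have e : deadSet parts 0 = {v | ∃ i, v ∈ parts i} := by simp [deadSet]
    rw [e]
    exact ⟨fun x y h => h.2, fun x y h h1 h2 => ⟨h, h1, h2⟩, ∅, by simp, fun x y _ _ h => h.1⟩
  | succ i ih =>
    intro hik
    obtain ⟨ih1, ih2, R, hR, ih3⟩ := ih (by omega)
    have hlt : i < k := hik
    obtain ⟨hcov, hNC, -⟩ := hP.2.2.2.2 ⟨i, hlt⟩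
    have hmono : ∀ x, x ∈ deadSet parts (i + 1) → x ∈ deadSet parts i := by
      rintro x ⟨j, hj, hx⟩; exact ⟨j, by omega, hx⟩
    have e2 : (lcChain G parts (i + 1)).2
        = chordalizeList (lcChain G parts (i + 1)).1 (parts ⟨i, hlt⟩) := by
      simp [lcChain, hlt]
    have e1 : (lcChain G parts (i + 1)).1
        = (lcChain G parts i).2 ⊔ removeVerts G (deadSet parts (i + 1)) := rfl
    rw [e2]
    simp only [] at hcov hNC
    generalize hH : (lcChain G parts (i + 1)).1 = H at *
    have hadj : ∀ x y, H.Adj x y ↔ (lcChain G parts i).2.Adj x y ∨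
        (G.Adj x y ∧ x ∉ deadSet parts (i + 1) ∧ y ∉ deadSet parts (i + 1)) := by
      intro x y; rw [e1]; rfl
    have hal : ∀ x y, H.Adj x y → x ∉ deadSet parts (i + 1) ∧ y ∉ deadSet parts (i + 1) := by
      intro x y h
      rcases (hadj x y).1 h with h | h
      · exact ⟨fun hx => (ih1 x y h).1 (hmono _ hx), fun hx => (ih1 x y h).2 (hmono _ hx)⟩
      · exact h.2
    have hGH : ∀ x y, G.Adj x y → x ∉ deadSet parts (i + 1) → y ∉ deadSet parts (i + 1) →
        H.Adj x y := fun x y h h1 h2 => (hadj x y).2 (Or.inr ⟨h, h1, h2⟩)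
    have hC : ∀ u ∈ {v | v ∈ parts ⟨i, hlt⟩}, ∀ x, H.Adj u x → G.Adj u x := by
      intro u hu x h
      rcases (hadj u x).1 h with h | h
      · exact absurd ⟨⟨i, hlt⟩, le_rfl, hu⟩ (ih1 u x h).1
      · exact h.1
    obtain ⟨h1, p, h2⟩ := step_one G H _ _ side Gcr Gtr hal hGH hC hcov hNC
      (parts ⟨i, hlt⟩) (fun u hu => hu)
    refine ⟨h1, fun x y h hx hy => le_chordalizeList _ _ (hGH x y h hx hy), insert p R,
      (Finset.card_insert_le _ _).trans (by omega), ?_⟩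
    intro x y hx hy h
    simp only [Finset.mem_insert, not_or] at hx hy
    rcases (hadj x y).1 (h2 x y hx.1 hy.1 h) with h | h
    · exact ih3 x y hx.2 hy.2 h
    · exact h.1

/-- Conclusion of the lower bound argument. -/
lemma chain_final (G : SimpleGraph V) (side : V → Bool)
    (Gcr : ∀ x y, side x ≠ side y → G.Adj x y)
    (Gtr : ∀ u x y, G.Adj u x → G.Adj u y → side x = side u → side y = side u → x ≠ y → G.Adj x y)
    {k : ℕ} (parts : Fin k → List V) (C : Set V) (hC : IsHoleCover G C)
    (hP : IsLCPartition G C parts) :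
    ∃ R : Finset V, R.card ≤ k ∧ ∃ c : Bool, ∀ x y, x ∉ R → y ∉ R → side x = c → side y = c →
      x ≠ y → G.Adj x y := by
  obtain ⟨-, h2, R, hR, h3⟩ := chain_inv G side Gcr Gtr parts C hP k le_rfl
  have hdead : ∀ x, x ∉ deadSet parts k := by
    rintro x ⟨j, hj, -⟩; exact absurd j.2 (by omega)
  have hk : k ≠ 0 := by
    rintro rfl
    obtain ⟨v, hv⟩ := hC.1
    rw [← hP.2.2.2.1] at hv
    obtain ⟨i, -⟩ := hv
    exact i.elim0
  have hch : IsChordal (lcChain G parts k).2 := by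
    have := (hP.2.2.2.2 ⟨k - 1, by omega⟩).2.2
    simpa [Nat.sub_add_cancel (Nat.pos_of_ne_zero hk)] using this
  generalize (lcChain G parts k).2 = K at *
  have hGK : ∀ x y, G.Adj x y → K.Adj x y := fun x y h => h2 x y h (hdead x) (hdead y)
  refine ⟨R, hR, ?_⟩
  by_contra hcon
  push Not at hcon
  obtain ⟨p, q, hp, hq, sp, sq, hpq, npq⟩ := hcon true
  obtain ⟨r, s, hr, hs, sr, ss, hrs, nrs⟩ := hcon false
  obtain ⟨w, hw, -⟩ := hole4 K (hGK _ _ (Gcr p r (by simp [sp, sr])))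
    (hGK _ _ (Gcr r q (by simp [sq, sr]))) (hGK _ _ (Gcr q s (by simp [sq, ss])))
    (hGK _ _ (Gcr s p (by simp [sp, ss]))) hpq hrs (fun h => npq (h3 _ _ hp hq h))
    (fun h => nrs (h3 _ _ hr hs h))
  exact hch _ w hw

/-! ### The example -/

/-- Vertex type of the example. -/
abbrev ExV (s t : ℕ) := Fin (s + t) ⊕ (Fin (s + t) → Fin (s + t))

/-- `(K_s ∪ j isolated vertices made complete)` joined with an independent set; the
vertices `s + j, …` of the first side are deleted. -/
def exGam (s t j : ℕ) : SimpleGraph (ExV s t) where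
  Adj x y := match x, y with
    | .inl a, .inl b => a ≠ b ∧ a.1 < s + j ∧ b.1 < s + j
    | .inl a, .inr _ => a.1 < s + j
    | .inr _, .inl b => b.1 < s + j
    | .inr _, .inr _ => False
  symm := ⟨by rintro (a | a) (b | b) h <;> simp_all; exact fun h' => h.1 h'.symm⟩
  loopless := ⟨by rintro (a | a) h <;> simp_all⟩

/-- The example: `(K_s ∪ t isolated vertices)` joined with an independent set. -/
def exG (s t : ℕ) : SimpleGraph (ExV s t) where
  Adj x y := match x, y with
    | .inl a, .inl b => a ≠ b ∧ a.1 < s ∧ b.1 < s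
    | .inl _, .inr _ => True
    | .inr _, .inl _ => True
    | .inr _, .inr _ => False
  symm := ⟨by rintro (a | a) (b | b) h <;> simp_all; exact fun h' => h.1 h'.symm⟩
  loopless := ⟨by rintro (a | a) h <;> simp_all⟩

section
variable (s t : ℕ)

@[simp] lemma exG_ll (a b) : (exG s t).Adj (.inl a) (.inl b) ↔ a ≠ b ∧ a.1 < s ∧ b.1 < s := Iff.rfl
@[simp] lemma exG_lr (a b) : (exG s t).Adj (.inl a) (.inr b) := trivial
@[simp] lemma exG_rl (a b) : (exG s t).Adj (.inr a) (.inl b) := trivial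
@[simp] lemma exG_rr (a b) : ¬ (exG s t).Adj (.inr a) (.inr b) := id
@[simp] lemma exGam_ll (j a b) :
    (exGam s t j).Adj (.inl a) (.inl b) ↔ a ≠ b ∧ a.1 < s + j ∧ b.1 < s + j := Iff.rfl
@[simp] lemma exGam_lr (j a b) : (exGam s t j).Adj (.inl a) (.inr b) ↔ a.1 < s + j := Iff.rfl
@[simp] lemma exGam_rl (j a b) : (exGam s t j).Adj (.inr a) (.inl b) ↔ b.1 < s + j := Iff.rfl
@[simp] lemma exGam_rr (j a b) : ¬ (exGam s t j).Adj (.inr a) (.inr b) := id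

lemma exG_cr (x y : ExV s t) (h : x.isLeft ≠ y.isLeft) : (exG s t).Adj x y := by
  rcases x with a | a <;> rcases y with b | b <;> simp_all

lemma exG_tr (u x y : ExV s t) (h1 : (exG s t).Adj u x) (h2 : (exG s t).Adj u y)
    (h3 : x.isLeft = u.isLeft) (h4 : y.isLeft = u.isLeft) (h : x ≠ y) : (exG s t).Adj x y := by
  rcases x with a | a <;> rcases y with b | b <;> rcases u with c | c <;> simp_all

lemma exGam_chordal (j : ℕ) : IsChordal (exGam s t j) := by
  intro a w hw
  have key : ∀ c, Sum.inl c ∉ w.support := by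
    intro c hc
    obtain ⟨x, y, z, hx, hy, hz, hux, huy, hxy, nxy, hzu, nuz, hxz⟩ := hole_local _ w hw hc
    rcases x with x | x <;> rcases z with z | z <;> simp at hux hxz nuz hzu <;> grind
  obtain ⟨x, y, z, hx, hy, hz, hux, -⟩ := hole_local _ w hw w.start_mem_support
  have ha := w.start_mem_support
  rcases x with x | x <;> rcases a with a | a
  · exact key _ hx
  · exact key _ hx
  · exact key _ ha
  · simp at hux

lemma exG_card_lower (hs : 0 < s) (ht : 0 < t) (k : ℕ) (C : Set (ExV s t))
    (parts : Fin k → List (ExV s t)) (hC : IsHoleCover (exG s t) C)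
    (hP : IsLCPartition (exG s t) C parts) : t ≤ k := by
  classical
  obtain ⟨R, hR, c, h⟩ := chain_final (exG s t) Sum.isLeft (exG_cr s t) (exG_tr s t) parts C hC hP
  by_contra hlt
  push Not at hlt
  -- an element outside of `R` in the range of an injective map
  have pick : ∀ {ι : Type} [Fintype ι] (f : ι → ExV s t), Function.Injective f →
      k < Fintype.card ι → ∃ i, f i ∉ R := by
    intro ι _ f hf hk
    by_contra hcon
    push Not at hcon
    have : (Finset.univ.image f).card ≤ R.card := by
      apply Finset.card_le_card
      intro x hx
      obtain ⟨i, -, rfl⟩ := Finset.mem_image.1 hx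
      exact hcon i
    rw [Finset.card_image_of_injective _ hf, Finset.card_univ] at this
    omega
  cases c with
  | true =>
    obtain ⟨i, hi⟩ := pick (ι := Fin t) (fun i => Sum.inl (Fin.natAdd s i))
      (fun i j h => by simpa using h) (by simpa using hlt)
    obtain ⟨⟨j, hj⟩, hj'⟩ := pick (ι := {a : Fin (s + t) // a ≠ Fin.natAdd s i})
      (fun a => Sum.inl a.1) (fun i j h => Subtype.ext (by simpa using h)) (by
        rw [Fintype.card_subtype_compl]; simp; omega)
    have := h _ _ hi hj' rfl rfl (by simpa using fun h => hj h.symm)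
    simp at this
  | false =>
    obtain ⟨i, hi⟩ := pick (ι := Fin (s + t)) (fun i => Sum.inr (fun _ => i))
      (fun i j h => by
        have h' := Sum.inr_injective h
        exact congrFun h' i) (by simp; omega)
    obtain ⟨⟨j, hj⟩, hj'⟩ := pick (ι := {a : Fin (s + t) // a ≠ i})
      (fun a => Sum.inr (fun _ => a.1)) (fun i j h => Subtype.ext (by
        have h' := Sum.inr_injective h
        exact congrFun h' i.1)) (by
        rw [Fintype.card_subtype_compl]; simp; omega)
    have := h _ _ hi hj' rfl rfl (by
      intro h
      have h' := Sum.inr_injective h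
      exact hj (congrFun h' i).symm)
    simp at this

/-- The parts of the optimal local chordalization partition. -/
def exParts (i : Fin t) : List (ExV s t) := [Sum.inl (Fin.natAdd s i)]

lemma exParts_dead (i : ℕ) (x : ExV s t) :
    x ∈ deadSet (exParts s t) i ↔ ∃ a : Fin (s + t), x = .inl a ∧ s + i ≤ a.1 := by
  constructor
  · rintro ⟨j, hj, hx⟩
    simp [exParts] at hx
    exact ⟨_, hx, by simp; omega⟩
  · rintro ⟨a, rfl, ha⟩
    refine ⟨⟨a.1 - s, by omega⟩, by simp; omega, ?_⟩
    simp [exParts, Fin.ext_iff]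
    omega

lemma exRemove_ll (i a b) :
    (removeVerts (exG s t) (deadSet (exParts s t) i)).Adj (.inl a) (.inl b) ↔
      a ≠ b ∧ a.1 < s ∧ b.1 < s := by
  simp only [removeVerts, exParts_dead, exG_ll]
  simp
  omega

lemma exRemove_lr (i a b) :
    (removeVerts (exG s t) (deadSet (exParts s t) i)).Adj (.inl a) (.inr b) ↔ a.1 < s + i := by
  simp only [removeVerts, exParts_dead]
  simp

lemma exRemove_rl (i a b) :
    (removeVerts (exG s t) (deadSet (exParts s t) i)).Adj (.inr a) (.inl b) ↔ b.1 < s + i := by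
  simp only [removeVerts, exParts_dead]
  simp

lemma exRemove_rr (i a b) :
    ¬ (removeVerts (exG s t) (deadSet (exParts s t) i)).Adj (.inr a) (.inr b) := by
  simp only [removeVerts, exParts_dead]
  simp

/-- The graph `G_{i+1}`. -/
def exMid (i : ℕ) : SimpleGraph (ExV s t) :=
  exGam s t i ⊔ removeVerts (exG s t) (deadSet (exParts s t) (i + 1))

lemma exMid_ll (i a b) : (exMid s t i).Adj (.inl a) (.inl b) ↔
      a ≠ b ∧ a.1 < s + i ∧ b.1 < s + i := by
  simp only [exMid, SimpleGraph.sup_adj, exRemove_ll, exGam_ll]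
  omega

lemma exMid_lr (i a b) : (exMid s t i).Adj (.inl a) (.inr b) ↔ a.1 < s + (i + 1) := by
  simp only [exMid, SimpleGraph.sup_adj, exRemove_lr, exGam_lr]
  omega

lemma exMid_rl (i a b) : (exMid s t i).Adj (.inr a) (.inl b) ↔ b.1 < s + (i + 1) := by
  simp only [exMid, SimpleGraph.sup_adj, exRemove_rl, exGam_rl]
  omega

lemma exMid_rr (i a b) : ¬ (exMid s t i).Adj (.inr a) (.inr b) := by
  simp only [exMid, SimpleGraph.sup_adj, exRemove_rr, exGam_rr, or_self, not_false_eq_true]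

lemma exMid_hole (i : Fin t) (a) (w : (exMid s t i).Walk a a) (hw : IsHole _ w) :
    Sum.inl (Fin.natAdd s i) ∈ w.support := by
  by_contra hni
  have key : ∀ c, Sum.inl c ∉ w.support := by
    intro c hc
    have hlt : ∀ d, Sum.inl d ∈ w.support → d.1 < s + i := by
      intro d hd
      obtain ⟨x, y, z, hx, hy, hz, hux, huy, hxy, nxy, hzu, nuz, hxz⟩ := hole_local _ w hw hd
      have h1 : d.1 < s + (i + 1) := by
        rcases x with x | x
        · rw [exMid_ll] at hux; omega
        · rw [exMid_lr] at hux; omega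
      have h2 : d.1 ≠ s + i := by
        intro h
        apply hni
        have : Fin.natAdd s i = d := by ext; simp [h]
        rw [this]; exact hd
      omega
    obtain ⟨x, y, z, hx, hy, hz, hux, huy, hxy, nxy, hzu, nuz, hxz⟩ := hole_local _ w hw hc
    rcases z with z | z
    · rw [exMid_ll] at nuz
      exact nuz ⟨fun h => hzu (by rw [h]), hlt _ hc, hlt _ hz⟩
    · rw [exMid_lr] at nuz
      have := hlt _ hc
      omega
  obtain ⟨x, y, z, hx, hy, hz, hux, -⟩ := hole_local _ w hw w.start_mem_support
  have ha := w.start_mem_support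
  rcases x with x | x <;> rcases a with a | a
  · exact key _ hx
  · exact key _ hx
  · exact key _ ha
  · exact exMid_rr _ _ _ _ _ hux

lemma exMid_chordalize (hs : 0 < s) (i : Fin t) :
    localChordalize (exMid s t i) (.inl (Fin.natAdd s i)) = exGam s t (i + 1) := by
  have alive : ∀ a (w : (exMid s t i).Walk a a), IsHole _ w → ∀ d, Sum.inl d ∈ w.support →
      d.1 < s + (i + 1) := by
    intro a w hw d hd
    obtain ⟨x, y, z, hx, hy, hz, hux, huy, hxy, nxy, hzu, nuz, hxz⟩ := hole_local _ w hw hd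
    rcases x with x | x
    · rw [exMid_ll] at hux; omega
    · rw [exMid_lr] at hux; omega
  have hmk : ∀ d : Fin (s + t), d.1 < s + i →
      (localChordalize (exMid s t i) (.inl (Fin.natAdd s i))).Adj
        (.inl (Fin.natAdd s i)) (.inl d) := by
    intro d hd
    have hne : Fin.natAdd s i ≠ d := by
      intro h; rw [← h] at hd; simp at hd
    have hit := i.2
    obtain ⟨w, hw, hsup, -⟩ := hole4 (exMid s t i) (p := .inl (Fin.natAdd s i))
      (r := .inr (fun _ => ⟨0, by omega⟩)) (q := .inl d) (s := .inr (fun _ => ⟨s, by omega⟩))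
      ((exMid_lr s t i _ _).2 (by simp)) ((exMid_rl s t i _ _).2 (by omega))
      ((exMid_lr s t i _ _).2 (by omega)) ((exMid_rl s t i _ _).2 (by simp))
      (by simpa using hne) (by
        intro h
        have h' := congrFun (Sum.inr_injective h) ⟨0, by omega⟩
        simp at h'; omega)
      (by rw [exMid_ll]; simp) (exMid_rr _ _ _ _ _)
    right
    rw [SimpleGraph.fromRel_adj]
    exact ⟨by simpa using hne, Or.inl ⟨rfl, _, w, hw, (hsup _).2 (by simp), (hsup _).2 (by simp)⟩⟩
  apply le_antisymm
  · intro x y h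
    have hor := localChordalize_adj _ _ h
    rcases x with x | x <;> rcases y with y | y
    · rw [exGam_ll]
      rcases hor with h | ⟨hne, -, a, w, hw, -, hx, hy⟩
      · rw [exMid_ll] at h; exact ⟨h.1, by omega, by omega⟩
      · exact ⟨fun h => hne (by rw [h]), alive _ w hw _ hx, alive _ w hw _ hy⟩
    · rw [exGam_lr]
      rcases hor with h | ⟨hne, -, a, w, hw, -, hx, hy⟩
      · rwa [exMid_lr] at h
      · exact alive _ w hw _ hx
    · rw [exGam_rl]
      rcases hor with h | ⟨hne, -, a, w, hw, -, hx, hy⟩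
      · rwa [exMid_rl] at h
      · exact alive _ w hw _ hy
    · rcases hor with h | ⟨hne, h | h, -⟩
      · exact absurd h (exMid_rr _ _ _ _ _)
      · simp at h
      · simp at h
  · intro x y h
    rcases x with x | x <;> rcases y with y | y
    · rw [exGam_ll] at h
      obtain ⟨hne, hx, hy⟩ := h
      by_cases hx' : x.1 < s + i
      · by_cases hy' : y.1 < s + i
        · exact localChordalize_le _ _ ((exMid_ll s t i x y).2 ⟨hne, hx', hy'⟩)
        · have : y = Fin.natAdd s i := by ext; simp; omega
          subst this
          exact (hmk x hx').symm
      · have : x = Fin.natAdd s i := by ext; simp; omega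
        subst this
        refine hmk y ?_
        have : y.1 ≠ s + i := fun h => hne (by ext; simp [h])
        omega
    · exact localChordalize_le _ _ ((exMid_lr s t i x y).2 h)
    · exact localChordalize_le _ _ ((exMid_rl s t i x y).2 h)
    · exact absurd h (exGam_rr _ _ _ _ _)

lemma exChain (hs : 0 < s) (i : ℕ) (hi : i ≤ t) :
    (lcChain (exG s t) (exParts s t) i).2 = exGam s t i := by
  induction i with
  | zero =>
    have e : {v | ∃ i, v ∈ exParts s t i} = deadSet (exParts s t) 0 := by simp [deadSet]
    simp only [lcChain, e]
    ext x y
    rcases x with x | x <;> rcases y with y | y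
    · rw [exRemove_ll, exGam_ll]; rfl
    · rw [exRemove_lr, exGam_lr]
    · rw [exRemove_rl, exGam_rl]
    · exact iff_of_false (exRemove_rr _ _ _ _ _) (exGam_rr _ _ _ _ _)
  | succ i ih =>
    have h1 : (lcChain (exG s t) (exParts s t) (i + 1)).2
        = chordalizeList ((lcChain (exG s t) (exParts s t) i).2 ⊔
          removeVerts (exG s t) (deadSet (exParts s t) (i + 1))) (exParts s t ⟨i, hi⟩) := by
      have : i < t := hi
      simp [lcChain, this, deadSet]
    rw [h1, ih (by omega)]
    exact exMid_chordalize s t hs ⟨i, hi⟩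

lemma exG_upper (hs : 0 < s) (ht : 0 < t) :
    ∃ (C : Set (ExV s t)) (parts : Fin t → List (ExV s t)),
      IsHoleCover (exG s t) C ∧ IsLCPartition (exG s t) C parts := by
  have hmid : ∀ i : Fin t, (lcChain (exG s t) (exParts s t) ((i : ℕ) + 1)).1 = exMid s t i := by
    intro i
    have : (lcChain (exG s t) (exParts s t) ((i : ℕ) + 1)).1
      = (lcChain (exG s t) (exParts s t) i).2 ⊔
          removeVerts (exG s t) (deadSet (exParts s t) (i + 1)) := rfl
    rw [this, exChain s t hs i (by omega)]
    rfl
  refine ⟨{v | ∃ i, v ∈ exParts s t i}, exParts s t, ⟨⟨.inl (Fin.natAdd s ⟨0, ht⟩), ⟨0, ht⟩,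
    by simp [exParts]⟩, ?_⟩, ?_, ?_, ?_, rfl, ?_⟩
  · intro a w hw
    by_contra hcon
    push Not at hcon
    have hlt : ∀ d, Sum.inl d ∈ w.support → d.1 < s := by
      intro d hd
      by_contra h
      refine hcon _ ⟨⟨d.1 - s, by omega⟩, ?_⟩ hd
      simp [exParts, Fin.ext_iff]; omega
    have key : ∀ c, Sum.inl c ∉ w.support := by
      intro c hc
      obtain ⟨x, y, z, hx, hy, hz, hux, huy, hxy, nxy, hzu, nuz, hxz⟩ := hole_local _ w hw hc
      rcases z with z | z
      · rw [exG_ll] at nuz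
        exact nuz ⟨fun h => hzu (by rw [h]), hlt _ hc, hlt _ hz⟩
      · exact nuz (exG_lr _ _ _ _)
    obtain ⟨x, y, z, hx, hy, hz, hux, -⟩ := hole_local _ w hw w.start_mem_support
    have ha := w.start_mem_support
    rcases x with x | x <;> rcases a with a | a
    · exact key _ hx
    · exact key _ hx
    · exact key _ ha
    · exact exG_rr _ _ _ _ hux
  · intro i; simp [exParts]
  · intro i; simp [exParts]
  · intro i j hij v hv hv'
    simp [exParts] at hv hv'
    rw [hv] at hv'
    simp [Fin.ext_iff] at hv'
    exact hij (Fin.ext hv')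
  · intro i
    rw [hmid i, exChain s t hs (i + 1) i.2]
    refine ⟨⟨⟨_, List.mem_singleton_self _⟩, fun a w hw =>
      ⟨_, List.mem_singleton_self _, exMid_hole s t i a w hw⟩⟩, ⟨?_, ?_⟩, exGam_chordal s t _⟩
    · intro u hu a b w₁ w₂ h1 h2 hu1 hu2
      have : u = .inl (Fin.natAdd s i) := by simpa [exParts] using hu
      subst this
      exact absurd (exMid_hole s t i _ w₂ h2) hu2
    · intro a w hw u hu v hv _ _
      have h1 : u = .inl (Fin.natAdd s i) := by simpa [exParts] using hu
      have h2 : v = .inl (Fin.natAdd s i) := by simpa [exParts] using hv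
      rw [h1, h2]

lemma exG_ncIndex (hs : 0 < s) : ncIndex (exG s t) = t := by
  classical
  rcases Nat.eq_zero_or_pos t with rfl | ht
  · have : exG s 0 = exGam s 0 0 := by
      ext x y
      rcases x with x | x <;> rcases y with y | y
      · rw [exG_ll, exGam_ll]; rfl
      · exact iff_of_true (exG_lr _ _ _ _) x.2
      · exact iff_of_true (exG_rl _ _ _ _) y.2
      · exact iff_of_false (exG_rr _ _ _ _) (exGam_rr _ _ _ _ _)
    have hch : IsChordal (exG s 0) := this ▸ exGam_chordal s 0 0
    simp [ncIndex, hch]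
  · have hch : ¬ IsChordal (exG s t) := by
      intro hch
      have hlt : (0 : ℕ) < s + t := by omega
      obtain ⟨w, hw, -⟩ := hole4 (exG s t) (p := .inl ⟨0, by omega⟩)
        (r := .inr (fun _ => ⟨0, by omega⟩)) (q := .inl ⟨s, by omega⟩)
        (s := .inr (fun _ => ⟨s, by omega⟩)) (by simp) (by simp) (by simp) (by simp)
        (by simp; omega) (by
          intro h
          have h' := congrFun (Sum.inr_injective h) ⟨0, by omega⟩
          simp at h'; omega) (by simp) (by simp)
      exact hch _ w hw
    simp only [ncIndex, hch, if_false]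
    apply le_antisymm
    · exact Nat.sInf_le (exG_upper s t hs ht)
    · apply le_csInf ⟨t, exG_upper s t hs ht⟩
      rintro k ⟨C, parts, hC, hP⟩
      exact exG_card_lower s t hs ht k C parts hC hP

lemma exG_listColorable : ListColorable (exG s t) (s + t + 1) := by
  classical
  intro L hL
  have hall : ∃ g : Fin (s + t) → ℕ, Function.Injective g ∧ ∀ a, g a ∈ L (.inl a) := by
    rw [← Finset.all_card_le_biUnion_card_iff_exists_injective (fun a => L (.inl a))]
    intro S
    rcases S.eq_empty_or_nonempty with rfl | ⟨a, ha⟩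
    · simp
    · have h1 := hL (.inl a)
      have h2 := Finset.card_le_card (Finset.subset_biUnion_of_mem (fun a => L (.inl a)) ha)
      have h3 := S.card_le_univ
      simp only [Fintype.card_fin] at h3
      omega
  obtain ⟨g, hg, hgL⟩ := hall
  have hb : ∀ b, ∃ c ∈ L (.inr b), c ∉ Finset.univ.image g := by
    intro b
    apply Finset.exists_mem_notMem_of_card_lt_card
    rw [Finset.card_image_of_injective _ hg]
    have := hL (.inr b)
    simp; omega
  choose f hf1 hf2 using hb
  refine ⟨Sum.elim g f, ?_, ?_⟩
  · rintro (a | a)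
    · exact hgL a
    · exact hf1 a
  · rintro (a | a) (b | b) h
    · simp only [exG_ll] at h
      exact fun h' => h.1 (hg h')
    · intro h'
      exact hf2 b (by rw [← show g a = f b from h']; simp)
    · intro h'
      exact hf2 a (by rw [show f a = g b from h']; simp)
    · exact absurd h (exG_rr _ _ _ _)

lemma exG_not_listColorable (hs : 0 < s) (k : ℕ) (hk : k ≤ s + t) :
    ¬ ListColorable (exG s t) k := by
  classical
  intro h
  let L : ExV s t → Finset ℕ := Sum.elim
    (fun a => Finset.univ.image fun j : Fin (s + t) => Nat.pair a j)
    (fun b => Finset.univ.image fun a : Fin (s + t) => Nat.pair a (b a))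
  obtain ⟨f, hf, hf'⟩ := h L (by
    rintro (a | b)
    · have : Function.Injective fun j : Fin (s + t) => Nat.pair a j := by
        intro i j h
        exact Fin.ext (Nat.pair_eq_pair.1 h).2
      simp only [L, Sum.elim_inl]
      rw [Finset.card_image_of_injective _ this]
      simpa using hk
    · have : Function.Injective fun a : Fin (s + t) => Nat.pair a (b a) := by
        intro i j h
        exact Fin.ext (Nat.pair_eq_pair.1 h).1
      simp only [L, Sum.elim_inr]
      rw [Finset.card_image_of_injective _ this]
      simpa using hk)
  have hA : ∀ a : Fin (s + t), ∃ j : Fin (s + t), Nat.pair a j = f (.inl a) := by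
    intro a
    have := hf (.inl a)
    simpa [L] using this
  choose g hg using hA
  have := hf (.inr g)
  simp only [L, Sum.elim_inr, Finset.mem_image] at this
  obtain ⟨a, -, ha⟩ := this
  exact hf' (.inl a) (.inr g) (exG_lr _ _ _ _) (by rw [← hg a, ha])

lemma exG_listChromaticNumber (hs : 0 < s) : listChromaticNumber (exG s t) = s + t + 1 := by
  apply le_antisymm
  · exact Nat.sInf_le (exG_listColorable s t)
  · apply le_csInf ⟨_, exG_listColorable s t⟩
    intro k hk
    by_contra h
    exact exG_not_listColorable s t hs k (by omega) hk

lemma exG_colorable (hs : 0 < s) : (exG s t).Colorable (s + 1) := by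
  refine ⟨SimpleGraph.Coloring.mk (Sum.elim
    (fun a => if h : a.1 < s then ⟨a.1, by omega⟩ else 0) (fun _ => Fin.last s)) ?_⟩
  rintro (a | a) (b | b) h
  · simp only [exG_ll] at h
    simp [h.2.1, h.2.2]
    exact fun h' => h.1 (Fin.ext h')
  · simp only [Sum.elim_inl, Sum.elim_inr, ne_eq, Fin.ext_iff]
    split <;> simp <;> omega
  · simp only [Sum.elim_inl, Sum.elim_inr, ne_eq, Fin.ext_iff]
    split <;> simp <;> omega
  · exact absurd h (exG_rr _ _ _ _)

lemma exG_clique (hs : 0 < s) : ∃ S : Finset (ExV s t), (exG s t).IsNClique (s + 1) S := by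
  classical
  have hn : 0 < s + t := by omega
  refine ⟨insert (.inr fun _ => ⟨0, hn⟩)
    (Finset.univ.image fun i : Fin s => Sum.inl (Fin.castAdd t i)), ?_, ?_⟩
  · intro x hx y hy hne
    simp only [Finset.coe_insert, Finset.coe_image, Finset.coe_univ, Set.image_univ,
      Set.mem_insert_iff, Set.mem_range] at hx hy
    rcases hx with rfl | ⟨i, rfl⟩ <;> rcases hy with rfl | ⟨j, rfl⟩
    · exact absurd rfl hne
    · simp
    · simp
    · simp at hne ⊢
      exact hne
  · rw [Finset.card_insert_of_notMem (by simp), Finset.card_image_of_injective]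
    · simp
    · intro i j h
      simpa using h

end

/-- for every positive integer `s` and nonnegative integer `t` there
is a finite simple graph `G` with `χ(G) = ω(G) = s + 1`, `i(G) = t`, and
`χ_l(G) = s + t + 1`. -/
theorem stmt18 (s t : ℕ) (hs : 0 < s) :
    ∃ (V : Type) (_ : Fintype V) (_ : DecidableEq V) (G : SimpleGraph V),
      G.chromaticNumber = (s + 1 : ℕ) ∧ G.cliqueNum = s + 1 ∧
        ncIndex G = t ∧ listChromaticNumber G = s + t + 1 := by

  obtain ⟨S, hS⟩ := exG_clique s t hs
  have hcol := exG_colorable s t hs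
  have hchi : (exG s t).chromaticNumber = (s + 1 : ℕ) := by
    apply le_antisymm hcol.chromaticNumber_le
    have := hS.isClique.card_le_chromaticNumber
    rwa [hS.card_eq] at this
  refine ⟨ExV s t, inferInstance, inferInstance, exG s t, hchi, ?_, exG_ncIndex s t hs,
    exG_listChromaticNumber s t hs⟩
  apply le_antisymm
  · obtain ⟨T, hT⟩ := (exG s t).exists_isNClique_cliqueNum
    have := hT.isClique.card_le_of_colorable hcol
    rwa [hT.card_eq] at this
  · have := hS.isClique.card_le_cliqueNum
    rwa [hS.card_eq] at this
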